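/- For every real α with 0 < α < 1, the limit as x → +∞ of x^α · E_α(−x^α) equals 1/Γ(1 − α). In particular, E_α(−x^α) → 0 as x → +∞. -/

import Mathlib

/-- The two-parameter Mittag-Leffler function `E_{α,β}(x) = ∑ x ^ k / Γ(α k + β)`
for real `x`. The classical Mittag-Leffler function is `E_α = E_{α,1}`. -/
noncomputable def mittagLeffler (α β : ℝ) (x : ℝ) : ℝ :=
  ∑' k : ℕ, x ^ k / Real.Gamma (α * k + β)

open MeasureTheory Set Filter Topology

theorem integral_rpow_mul_sub_rpow {a b t : ℝ} (ha : 0 < a) (hb : 0 < b) (ht : 0 < t) :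
    ∫ s in (0 : ℝ)..t, s ^ (a - 1) * (t - s) ^ (b - 1) =
      t ^ (a + b - 1) * ProbabilityTheory.beta a b := by
  have h := Complex.betaIntegral_scaled a b ht
  have h2 : ∫ s in (0 : ℝ)..t, (s : ℂ) ^ ((a : ℂ) - 1) * ((t : ℂ) - s) ^ ((b : ℂ) - 1) =
      ((∫ s in (0 : ℝ)..t, s ^ (a - 1) * (t - s) ^ (b - 1) : ℝ) : ℂ) := by
    rw [← intervalIntegral.integral_ofReal]
    refine intervalIntegral.integral_congr fun s hs => ?_
    rw [uIcc_of_le ht.le] at hs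
    simp only [Complex.ofReal_mul]
    rw [Complex.ofReal_cpow hs.1, Complex.ofReal_cpow (sub_nonneg.2 hs.2)]
    push_cast
    rfl
  rw [h2] at h
  have h3 := congrArg Complex.re h
  have h4 : (t : ℂ) ^ ((a : ℂ) + b - 1) = ((t ^ (a + b - 1) : ℝ) : ℂ) := by
    rw [Complex.ofReal_cpow ht.le]; push_cast; rfl
  rw [h4, Complex.ofReal_re, Complex.re_ofReal_mul,
    ← ProbabilityTheory.beta_eq_betaIntegralReal a b ha hb] at h3
  exact h3

theorem intervalIntegrable_rpow_mul_sub_rpow {a b t : ℝ} (ha : 0 < a) (hb : 0 < b) (ht : 0 < t) :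
    IntervalIntegrable (fun s : ℝ => s ^ (a - 1) * (t - s) ^ (b - 1)) volume 0 t := by
  refine intervalIntegral.intervalIntegrable_of_integral_ne_zero ?_
  rw [integral_rpow_mul_sub_rpow ha hb ht]
  exact (mul_pos (Real.rpow_pos_of_pos ht _) (ProbabilityTheory.beta_pos ha hb)).ne'

theorem rpow_mul_exp_neg_le_Gamma {A y : ℝ} (hA : 0 < A) (hy : 0 ≤ y) :
    A ^ y * Real.exp (-A) ≤ Real.Gamma (y + 1) := by
  have hi := Real.GammaIntegral_convergent (s := y + 1) (by linarith)
  rw [Real.Gamma_eq_integral (by linarith), ← integral_exp_neg_Ioi A, ← integral_const_mul]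
  have hsub : Ioi A ⊆ Ioi 0 := Ioi_subset_Ioi hA.le
  calc ∫ x in Ioi A, A ^ y * Real.exp (-x)
      ≤ ∫ x in Ioi A, Real.exp (-x) * x ^ (y + 1 - 1) := by
        refine setIntegral_mono_on ((integrableOn_exp_neg_Ioi A).const_mul _)
          (hi.mono_set hsub) measurableSet_Ioi fun x hx => ?_
        rw [mul_comm, add_sub_cancel_right]
        gcongr
        exact (mem_Ioi.1 hx).le
    _ ≤ ∫ x in Ioi 0, Real.exp (-x) * x ^ (y + 1 - 1) := by
        refine setIntegral_mono_set hi ?_ (Eventually.of_forall hsub)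
        refine ae_restrict_of_forall_mem measurableSet_Ioi fun x hx => ?_
        have : (0 : ℝ) < x := hx
        positivity

theorem summable_pow_div_Gamma {α β : ℝ} (hα : 0 < α) (hβ : 0 < β) {R : ℝ} (hR : 0 ≤ R) :
    Summable fun k : ℕ => R ^ k / Real.Gamma (α * k + β) := by
  set A : ℝ := (2 * (R + 1)) ^ (1 / α) with hA
  have hA0 : 0 < A := by positivity
  have hAα : A ^ α = 2 * (R + 1) := by
    rw [hA, ← Real.rpow_mul (by positivity), one_div_mul_cancel hα.ne', Real.rpow_one]
  set q : ℝ := R / (2 * (R + 1)) with hq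
  have hq0 : 0 ≤ q := by positivity
  have hq1 : q < 1 := by rw [hq, div_lt_one (by positivity)]; linarith
  have h1 : Summable fun k : ℕ => (k : ℝ) ^ 1 * q ^ k :=
    summable_pow_mul_geometric_of_norm_lt_one 1 (by rwa [Real.norm_of_nonneg hq0])
  have h2 : Summable fun k : ℕ => q ^ k := summable_geometric_of_lt_one hq0 hq1
  refine Summable.of_nonneg_of_le (fun k => ?_) (fun k => ?_)
    (((h1.mul_left α).add (h2.mul_left β)).mul_left (Real.exp A * A ^ (-β)))
  · have : 0 < Real.Gamma (α * k + β) := Real.Gamma_pos_of_pos (by positivity)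
    positivity
  · have hy : 0 < α * k + β := by positivity
    have hG := rpow_mul_exp_neg_le_Gamma hA0 hy.le
    have hG0 := Real.Gamma_pos_of_pos hy
    rw [Real.Gamma_add_one hy.ne', Real.rpow_add hA0, Real.rpow_mul hA0.le, hAα,
      Real.rpow_natCast, Real.exp_neg] at hG
    rw [div_le_iff₀ hG0, Real.rpow_neg hA0.le, hq, div_pow]
    have hp : 0 < (2 * (R + 1)) ^ k := by positivity
    have hE := Real.exp_pos A
    have hB : 0 < A ^ β := by positivity
    calc R ^ k = Real.exp A * (A ^ β)⁻¹ * (R ^ k / (2 * (R + 1)) ^ k) *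
          ((2 * (R + 1)) ^ k * A ^ β * (Real.exp A)⁻¹) := by field_simp
      _ ≤ Real.exp A * (A ^ β)⁻¹ * (R ^ k / (2 * (R + 1)) ^ k) *
          ((α * k + β) * Real.Gamma (α * k + β)) := by gcongr
      _ = _ := by ring

theorem mittagLeffler_eq_inv_Gamma_add {α β : ℝ} (hα : 0 < α) (hβ : 0 < β) (x : ℝ) :
    mittagLeffler α β x = 1 / Real.Gamma β + x * mittagLeffler α (β + α) x := by
  have hs : Summable fun k : ℕ => x ^ k / Real.Gamma (α * k + β) := by
    refine Summable.of_norm ?_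
    convert summable_pow_div_Gamma hα hβ (abs_nonneg x) using 2 with k
    rw [norm_div, norm_pow, Real.norm_eq_abs,
      Real.norm_of_nonneg (Real.Gamma_pos_of_pos (by positivity)).le]
  unfold mittagLeffler
  rw [hs.tsum_eq_zero_add, ← tsum_mul_left]
  congr 1
  · simp
  · congr 1 with k
    have : α * ((k + 1 : ℕ) : ℝ) + β = α * k + (β + α) := by push_cast; ring
    rw [this]
    ring

theorem continuous_mittagLeffler {α β : ℝ} (hα : 0 < α) (hβ : 0 < β) :
    Continuous (mittagLeffler α β) := by
  refine continuous_iff_continuousAt.2 fun x => ?_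
  have hc : ContinuousOn (mittagLeffler α β) (Metric.ball 0 (|x| + 1)) := by
    refine continuousOn_tsum (fun k => by fun_prop)
      (summable_pow_div_Gamma hα hβ (R := |x| + 1) (by positivity)) fun k y hy => ?_
    have : 0 < Real.Gamma (α * k + β) := Real.Gamma_pos_of_pos (by positivity)
    rw [norm_div, norm_pow, Real.norm_of_nonneg this.le]
    rw [mem_ball_zero_iff] at hy
    gcongr
  exact hc.continuousAt (Metric.isOpen_ball.mem_nhds (by simp))

/-- The relaxation kernel `t ^ (β - 1) * E_{α,β}(-t ^ α)`. -/
noncomputable def mittagLefflerKernel (α β t : ℝ) : ℝ :=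
  t ^ (β - 1) * mittagLeffler α β (-(t ^ α))

theorem continuousOn_mittagLefflerKernel {α β : ℝ} (hα : 0 < α) (hβ : 0 < β) :
    ContinuousOn (mittagLefflerKernel α β) (Ioi 0) := by
  have h1 : Continuous fun t : ℝ => mittagLeffler α β (-(t ^ α)) :=
    (continuous_mittagLeffler hα hβ).comp (Real.continuous_rpow_const hα.le).neg
  exact (continuousOn_id.rpow_const fun t ht => Or.inl (ne_of_gt ht)).mul h1.continuousOn

theorem mittagLefflerKernel_add {α β t : ℝ} (hα : 0 < α) (hβ : 0 < β) (ht : 0 < t) :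
    mittagLefflerKernel α β t + mittagLefflerKernel α (β + α) t =
      t ^ (β - 1) / Real.Gamma β := by
  unfold mittagLefflerKernel
  rw [mittagLeffler_eq_inv_Gamma_add hα hβ, show β + α - 1 = (β - 1) + α by ring,
    Real.rpow_add ht]
  ring

theorem intervalIntegrable_mittagLefflerKernel_mul {α β γ t : ℝ} (hα : 0 < α) (hβ : 0 < β)
    (hγ : 0 < γ) (ht : 0 < t) :
    IntervalIntegrable (fun s => mittagLefflerKernel α β s * (t - s) ^ (γ - 1)) volume 0 t := by
  have h1 : Continuous fun t : ℝ => mittagLeffler α β (-(t ^ α)) :=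
    (continuous_mittagLeffler hα hβ).comp (Real.continuous_rpow_const hα.le).neg
  refine ((intervalIntegrable_rpow_mul_sub_rpow hβ hγ ht).mul_continuousOn
    h1.continuousOn).congr (fun s _ => ?_)
  simp only [mittagLefflerKernel]
  ring

theorem integral_mittagLefflerKernel_mul {α β γ t : ℝ} (hα : 0 < α) (hβ : 0 < β)
    (hγ : 0 < γ) (ht : 0 < t) :
    ∫ s in (0 : ℝ)..t, mittagLefflerKernel α β s * (t - s) ^ (γ - 1) =
      Real.Gamma γ * mittagLefflerKernel α (β + γ) t := by
  set F : ℕ → ℝ → ℝ := fun k s =>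
    (-1) ^ k / Real.Gamma (α * k + β) * (s ^ (α * k + β - 1) * (t - s) ^ (γ - 1)) with hF
  have hpos (k : ℕ) : 0 < α * k + β := by positivity
  have hG (k : ℕ) := Real.Gamma_pos_of_pos (hpos k)
  have hbeta (k : ℕ) : ∫ s in (0 : ℝ)..t, s ^ (α * k + β - 1) * (t - s) ^ (γ - 1) =
      t ^ (β + γ - 1) * (t ^ α) ^ k *
        (Real.Gamma (α * k + β) * Real.Gamma γ / Real.Gamma (α * k + (β + γ))) := by
    rw [integral_rpow_mul_sub_rpow (hpos k) hγ ht, ProbabilityTheory.beta, ← Real.rpow_natCast,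
      ← Real.rpow_mul ht.le, ← Real.rpow_add ht]
    congr 2
    · ring
    · rw [add_assoc]
  have hint (k : ℕ) : Integrable (F k) (volume.restrict (Ioc 0 t)) :=
    ((intervalIntegrable_iff_integrableOn_Ioc_of_le ht.le).1
      (intervalIntegrable_rpow_mul_sub_rpow (hpos k) hγ ht)).const_mul _
  have hnorm (k : ℕ) : ∫ s in Ioc 0 t, ‖F k s‖ =
      t ^ (β + γ - 1) * Real.Gamma γ * ((t ^ α) ^ k / Real.Gamma (α * k + (β + γ))) := by
    have : ∫ s in Ioc 0 t, ‖F k s‖ = ∫ s in Ioc 0 t,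
        1 / Real.Gamma (α * k + β) * (s ^ (α * k + β - 1) * (t - s) ^ (γ - 1)) := by
      refine setIntegral_congr_fun measurableSet_Ioc fun s hs => ?_
      have h1 : 0 ≤ s ^ (α * k + β - 1) * (t - s) ^ (γ - 1) :=
        mul_nonneg (Real.rpow_nonneg hs.1.le _) (Real.rpow_nonneg (sub_nonneg.2 hs.2) _)
      simp only [hF, norm_mul, norm_div, norm_pow, norm_neg, norm_one, one_pow,
        Real.norm_of_nonneg (hG k).le]
      rw [← norm_mul, Real.norm_of_nonneg h1]
    rw [this, integral_const_mul, ← intervalIntegral.integral_of_le ht.le, hbeta]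
    have := hG k
    field_simp
  have hsum := hasSum_integral_of_summable_integral_norm hint (by
    simp_rw [hnorm]
    exact (summable_pow_div_Gamma hα (add_pos hβ hγ) (Real.rpow_nonneg ht.le α)).mul_left _)
  have hval : ∫ s in Ioc 0 t, ∑' k, F k s =
      ∫ s in (0 : ℝ)..t, mittagLefflerKernel α β s * (t - s) ^ (γ - 1) := by
    rw [intervalIntegral.integral_of_le ht.le]
    refine setIntegral_congr_fun measurableSet_Ioc fun s hs => ?_
    simp only [mittagLefflerKernel, mittagLeffler]
    rw [← tsum_mul_left, ← tsum_mul_right]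
    refine tsum_congr fun k => ?_
    simp only [hF]
    rw [neg_pow, show α * (k : ℝ) + β - 1 = α * k + (β - 1) by ring, Real.rpow_add hs.1,
      Real.rpow_mul hs.1.le, Real.rpow_natCast]
    ring
  rw [← hval, ← hsum.tsum_eq, mittagLefflerKernel, mittagLeffler, ← mul_assoc, ← tsum_mul_left]
  refine tsum_congr fun k => ?_
  rw [integral_const_mul, ← intervalIntegral.integral_of_le ht.le, hbeta, neg_pow (t ^ α)]
  have := hG k
  field_simp

theorem intervalIntegrable_mittagLefflerKernel {α β t : ℝ} (hα : 0 < α) (hβ : 0 < β)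
    (ht : 0 < t) : IntervalIntegrable (mittagLefflerKernel α β) volume 0 t := by
  simpa using intervalIntegrable_mittagLefflerKernel_mul hα hβ one_pos ht

theorem integral_mittagLefflerKernel {α β t : ℝ} (hα : 0 < α) (hβ : 0 < β) (ht : 0 < t) :
    ∫ s in (0 : ℝ)..t, mittagLefflerKernel α β s = mittagLefflerKernel α (β + 1) t := by
  simpa using integral_mittagLefflerKernel_mul hα hβ one_pos ht

theorem integral_mittagLefflerKernel_eq_sub {α β a b : ℝ} (hα : 0 < α) (hβ : 0 < β)
    (ha : 0 < a) (hb : 0 < b) :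
    ∫ s in a..b, mittagLefflerKernel α β s =
      mittagLefflerKernel α (β + 1) b - mittagLefflerKernel α (β + 1) a := by
  rw [← integral_mittagLefflerKernel hα hβ ha, ← integral_mittagLefflerKernel hα hβ hb,
    intervalIntegral.integral_interval_sub_left
      (intervalIntegrable_mittagLefflerKernel hα hβ hb)
      (intervalIntegrable_mittagLefflerKernel hα hβ ha)]

theorem integral_sub_rpow {α a b : ℝ} (hα : 0 < α) :
    ∫ s in a..b, (b - s) ^ (α - 1) = (b - a) ^ α / α := by
  rw [intervalIntegral.integral_comp_sub_left (fun s => s ^ (α - 1)),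
    integral_rpow (Or.inl (by linarith))]
  simp [hα.ne']

theorem intervalIntegrable_sub_rpow {α a b : ℝ} (hα : 0 < α) :
    IntervalIntegrable (fun s => (b - s) ^ (α - 1)) volume a b := by
  have h := (intervalIntegral.intervalIntegrable_rpow' (a := b - a) (b := 0)
    (r := α - 1) (by linarith)).comp_sub_left b
  simpa using h

/-- A Volterra-type argument: at a first zero `t₀` the resolvent equation at `t₀` and at a point
`t < t₀` maximizing the kernel near `t₀` are incompatible. -/
theorem mittagLefflerKernel_self_pos {α t : ℝ} (hα : 0 < α) (hα1 : α < 1) (ht : 0 < t) :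
    0 < mittagLefflerKernel α α t := by
  have hpc : Continuous fun t : ℝ => mittagLeffler α α (-(t ^ α)) :=
    (continuous_mittagLeffler hα hα).comp (Real.continuous_rpow_const hα.le).neg
  have hΓ := Real.Gamma_pos_of_pos hα
  have hp0 : 0 < mittagLeffler α α (-((0 : ℝ) ^ α)) := by
    rw [mittagLeffler_eq_inv_Gamma_add hα hα, Real.zero_rpow hα.ne']
    simpa using hΓ
  refine mul_pos (Real.rpow_pos_of_pos ht _) ?_
  by_contra! hneg
  obtain ⟨t₀, ⟨⟨ht₀, hp⟩, hmin⟩⟩ :=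
    ((isCompact_Icc (a := 0) (b := t)).inter_right
      (isClosed_le hpc continuous_const)).exists_isLeast ⟨t, ⟨ht.le, le_rfl⟩, hneg⟩
  rw [mem_ofPred_eq] at hp
  have ht₀0 : 0 < t₀ := by
    refine lt_of_le_of_ne ht₀.1 fun h => ?_
    rw [← h] at hp
    linarith
  set h := mittagLefflerKernel α α with hh
  have hpos : ∀ s, 0 < s → s < t₀ → 0 < h s := fun s hs hst => by
    refine mul_pos (Real.rpow_pos_of_pos hs _) ?_
    by_contra! hc
    exact absurd (hmin ⟨⟨hs.le, hst.le.trans ht₀.2⟩, hc⟩) (not_le.2 hst)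
  have hht₀ : h t₀ ≤ 0 := mul_nonpos_of_nonneg_of_nonpos (Real.rpow_nonneg ht₀.1 _) hp
  have heq : ∀ u, 0 < u →
      Real.Gamma α * u ^ (1 - α) * h u = 1 - u ^ (1 - α) * ∫ s in (0 : ℝ)..u,
        h s * (u - s) ^ (α - 1) := fun u hu => by
    have h1 := mittagLefflerKernel_add hα hα hu
    have h2 := integral_mittagLefflerKernel_mul hα hα hα hu
    rw [h2, eq_sub_iff_add_eq]
    have h3 : u ^ (1 - α) * u ^ (α - 1) = 1 := by rw [← Real.rpow_add hu]; simp
    calc _ = u ^ (1 - α) * Real.Gamma α * (h u + mittagLefflerKernel α (α + α) u) := by ring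
      _ = u ^ (1 - α) * u ^ (α - 1) := by rw [h1]; field_simp
      _ = 1 := h3
  obtain ⟨t₁, hsmall, ht₁, ht₁0⟩ : ∃ t₁, t₀ ^ (1 - α) * ((t₀ - t₁) ^ α / α) <
      Real.Gamma α * t₁ ^ (1 - α) ∧ t₁ < t₀ ∧ 0 < t₁ := by
    have hc1 : Continuous fun u : ℝ => t₀ ^ (1 - α) * ((t₀ - u) ^ α / α) :=
      (((Real.continuous_rpow_const hα.le).comp
        (continuous_const.sub continuous_id)).div_const _).const_mul _
    have hc2 : Continuous fun u : ℝ => Real.Gamma α * u ^ (1 - α) :=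
      (Real.continuous_rpow_const (by linarith)).const_mul _
    have hev : ∀ᶠ u in 𝓝 t₀, t₀ ^ (1 - α) * ((t₀ - u) ^ α / α) < Real.Gamma α * u ^ (1 - α) := by
      refine hc1.continuousAt.eventually_lt hc2.continuousAt ?_
      rw [sub_self, Real.zero_rpow hα.ne']
      simp only [zero_div, mul_zero]
      positivity
    have hev2 : ∀ᶠ u in 𝓝[<] t₀, u < t₀ := eventually_mem_nhdsWithin
    exact ((hev.filter_mono nhdsWithin_le_nhds).and (hev2.and
      ((eventually_gt_nhds ht₀0).filter_mono nhdsWithin_le_nhds))).exists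
  have hcont : ContinuousOn h (Ioi 0) := continuousOn_mittagLefflerKernel hα hα
  obtain ⟨u, hu, humax⟩ := isCompact_Icc.exists_isMaxOn (nonempty_Icc.2 ht₁.le)
    (hcont.mono fun x hx => lt_of_lt_of_le ht₁0 hx.1)
  have hu0 : 0 < u := ht₁0.trans_le hu.1
  have hut : u < t₀ := by
    refine lt_of_le_of_ne hu.2 fun hc => ?_
    have h1 : h t₁ ≤ h u := humax ⟨le_rfl, ht₁.le⟩
    rw [hc] at h1
    linarith [hpos t₁ ht₁0 ht₁]
  have hhu := hpos u hu0 hut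
  have hi : ∀ v, 0 < v → IntervalIntegrable (fun s => h s * (v - s) ^ (α - 1)) volume 0 v :=
    fun v hv => intervalIntegrable_mittagLefflerKernel_mul hα hα hα hv
  have hi1 : IntervalIntegrable (fun s => h s * (t₀ - s) ^ (α - 1)) volume 0 u :=
    (hi t₀ ht₀0).mono_set (by
      rw [uIcc_of_le hu0.le, uIcc_of_le ht₀0.le]; exact Icc_subset_Icc_right hut.le)
  have hi2 : IntervalIntegrable (fun s => h s * (t₀ - s) ^ (α - 1)) volume u t₀ :=
    (hi t₀ ht₀0).mono_set (by
      rw [uIcc_of_le hut.le, uIcc_of_le ht₀0.le]; exact Icc_subset_Icc_left hu0.le)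
  have hsplit := intervalIntegral.integral_add_adjacent_intervals hi1 hi2
  have hleft : t₀ ^ (1 - α) * ∫ s in (0 : ℝ)..u, h s * (t₀ - s) ^ (α - 1) ≤
      u ^ (1 - α) * ∫ s in (0 : ℝ)..u, h s * (u - s) ^ (α - 1) := by
    rw [← intervalIntegral.integral_const_mul, ← intervalIntegral.integral_const_mul]
    refine intervalIntegral.integral_mono_on_of_le_Ioo hu0.le (hi1.const_mul _)
      ((hi u hu0).const_mul _) fun s hs => ?_
    have hs1 : 0 < u - s := sub_pos.2 hs.2
    have hs2 : 0 < t₀ - s := sub_pos.2 (hs.2.trans hut)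
    have key : t₀ ^ (1 - α) * (t₀ - s) ^ (α - 1) ≤ u ^ (1 - α) * (u - s) ^ (α - 1) := by
      rw [← neg_sub 1 α, Real.rpow_neg hs1.le, Real.rpow_neg hs2.le, ← div_eq_mul_inv,
        ← div_eq_mul_inv, ← Real.div_rpow ht₀0.le hs2.le, ← Real.div_rpow hu0.le hs1.le]
      refine Real.rpow_le_rpow (by positivity) ?_ (by linarith)
      rw [div_le_div_iff₀ hs2 hs1]
      nlinarith [hs.1]
    calc _ = h s * (t₀ ^ (1 - α) * (t₀ - s) ^ (α - 1)) := by ring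
      _ ≤ h s * (u ^ (1 - α) * (u - s) ^ (α - 1)) :=
        mul_le_mul_of_nonneg_left key (hpos s hs.1 (hs.2.trans hut)).le
      _ = _ := by ring
  have hright : ∫ s in u..t₀, h s * (t₀ - s) ^ (α - 1) ≤ h u * ((t₀ - u) ^ α / α) := by
    rw [← integral_sub_rpow hα, ← intervalIntegral.integral_const_mul]
    refine intervalIntegral.integral_mono_on hut.le hi2
      ((intervalIntegrable_sub_rpow hα).const_mul _) fun s hs => ?_
    exact mul_le_mul_of_nonneg_right (humax ⟨hu.1.trans hs.1, hs.2⟩)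
      (Real.rpow_nonneg (sub_nonneg.2 hs.2) _)
  have e1 := heq u hu0
  have e2 := heq t₀ ht₀0
  have hT : 0 < t₀ ^ (1 - α) := Real.rpow_pos_of_pos ht₀0 _
  have e3 : Real.Gamma α * t₀ ^ (1 - α) * h t₀ ≤ 0 :=
    mul_nonpos_of_nonneg_of_nonpos (by positivity) hht₀
  have e4 := mul_le_mul_of_nonneg_left hright hT.le
  rw [← hsplit] at e2
  have e5 : Real.Gamma α * u ^ (1 - α) * h u ≤ t₀ ^ (1 - α) * ((t₀ - u) ^ α / α) * h u := by
    linarith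
  have e6 := le_of_mul_le_mul_right e5 hhu
  have e7 : Real.Gamma α * t₁ ^ (1 - α) ≤ Real.Gamma α * u ^ (1 - α) := by
    have := hu.1
    gcongr
  have e8 : t₀ ^ (1 - α) * ((t₀ - u) ^ α / α) ≤ t₀ ^ (1 - α) * ((t₀ - t₁) ^ α / α) := by
    have := hu.1
    have : 0 ≤ t₀ - u := by linarith
    gcongr
  linarith

theorem mittagLefflerKernel_nonneg_of_add {α β γ t : ℝ} (hα : 0 < α) (hβ : 0 < β) (hγ : 0 < γ)
    (ht : 0 < t) (h : ∀ s, 0 < s → 0 ≤ mittagLefflerKernel α β s) :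
    0 ≤ mittagLefflerKernel α (β + γ) t := by
  have h1 := integral_mittagLefflerKernel_mul hα hβ hγ ht
  have h2 : 0 ≤ ∫ s in (0 : ℝ)..t, mittagLefflerKernel α β s * (t - s) ^ (γ - 1) := by
    rw [intervalIntegral.integral_of_le ht.le]
    exact setIntegral_nonneg measurableSet_Ioc fun s hs =>
      mul_nonneg (h s hs.1) (Real.rpow_nonneg (sub_nonneg.2 hs.2) _)
  rw [h1] at h2
  exact nonneg_of_mul_nonneg_right h2 (Real.Gamma_pos_of_pos hγ)

theorem mittagLefflerKernel_one_add {α t : ℝ} (hα : 0 < α) (ht : 0 < t) :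
    mittagLefflerKernel α 1 t + mittagLefflerKernel α (α + 1) t = 1 := by
  rw [add_comm α 1, mittagLefflerKernel_add hα one_pos ht]
  simp

theorem mittagLefflerKernel_one_antitoneOn {α : ℝ} (hα : 0 < α) (hα1 : α < 1) :
    AntitoneOn (mittagLefflerKernel α 1) (Ioi 0) := by
  intro a ha b hb hab
  rw [mem_Ioi] at ha hb
  have h1 := integral_mittagLefflerKernel_eq_sub hα hα ha hb
  have h2 : 0 ≤ ∫ s in a..b, mittagLefflerKernel α α s :=
    intervalIntegral.integral_nonneg hab fun s hs =>
      (mittagLefflerKernel_self_pos hα hα1 (ha.trans_le hs.1)).le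
  linarith [mittagLefflerKernel_one_add hα ha, mittagLefflerKernel_one_add hα hb]

theorem sub_mul_le_mittagLefflerKernel_sub {α a b : ℝ} (hα : 0 < α) (hα1 : α < 1) (ha : 0 < a)
    (hab : a ≤ b) :
    (b - a) * mittagLefflerKernel α 1 b ≤
      mittagLefflerKernel α (1 + 1) b - mittagLefflerKernel α (1 + 1) a := by
  have hb := ha.trans_le hab
  rw [← integral_mittagLefflerKernel_eq_sub hα one_pos ha hb, ← smul_eq_mul,
    ← intervalIntegral.integral_const]
  refine intervalIntegral.integral_mono_on hab intervalIntegrable_const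
    ((continuousOn_mittagLefflerKernel hα one_pos).mono ?_).intervalIntegrable fun s hs => ?_
  · rw [uIcc_of_le hab]
    exact fun x hx => ha.trans_le hx.1
  · exact mittagLefflerKernel_one_antitoneOn hα hα1 (ha.trans_le hs.1) hb hs.2

theorem mittagLefflerKernel_sub_le_sub_mul {α a b : ℝ} (hα : 0 < α) (hα1 : α < 1) (ha : 0 < a)
    (hab : a ≤ b) :
    mittagLefflerKernel α (1 + 1) b - mittagLefflerKernel α (1 + 1) a ≤
      (b - a) * mittagLefflerKernel α 1 a := by
  have hb := ha.trans_le hab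
  rw [← integral_mittagLefflerKernel_eq_sub hα one_pos ha hb, ← smul_eq_mul,
    ← intervalIntegral.integral_const]
  refine intervalIntegral.integral_mono_on hab
    ((continuousOn_mittagLefflerKernel hα one_pos).mono ?_).intervalIntegrable
    intervalIntegrable_const fun s hs => ?_
  · rw [uIcc_of_le hab]
    exact fun x hx => ha.trans_le hx.1
  · exact mittagLefflerKernel_one_antitoneOn hα hα1 ha (ha.trans_le hs.1) hs.1

theorem mittagLefflerKernel_one_nonneg {α t : ℝ} (hα : 0 < α) (hα1 : α < 1) (ht : 0 < t) :
    0 ≤ mittagLefflerKernel α 1 t := by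
  by_contra! hneg
  set c := mittagLefflerKernel α (1 + 1) t
  have hnonneg : ∀ s, 0 < s → 0 ≤ mittagLefflerKernel α (1 + 1) s := fun s hs => by
    have h := mittagLefflerKernel_nonneg_of_add hα (by linarith : 0 < α + 1)
      (by linarith : 0 < 1 - α) hs fun u hu => mittagLefflerKernel_nonneg_of_add hα hα one_pos hu
        fun v hv => (mittagLefflerKernel_self_pos hα hα1 hv).le
    rwa [show α + 1 + (1 - α) = 1 + 1 by ring] at h
  have hc : 0 ≤ c := hnonneg t ht
  set f := mittagLefflerKernel α 1 t
  have hd : 0 < (c + 1) / -f := div_pos (by linarith) (by linarith)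
  have h1 := mittagLefflerKernel_sub_le_sub_mul hα hα1 ht
    (by linarith : t ≤ t + (c + 1) / -f)
  have h2 := hnonneg (t + (c + 1) / -f) (by linarith)
  have h3 : (t + (c + 1) / -f - t) * f = -(c + 1) := by
    rw [add_sub_cancel_left, div_neg, neg_mul, div_mul_cancel₀ _ hneg.ne]
  change _ - c ≤ _ * f at h1
  linarith

theorem mittagLefflerKernel_one_le_rpow_neg {α t : ℝ} (hα : 0 < α) (hα1 : α < 1) (ht : 0 < t) :
    mittagLefflerKernel α 1 t ≤ α * Real.Gamma α * t ^ (-α) := by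
  have hΓ := Real.Gamma_pos_of_pos hα
  have h1 := integral_mittagLefflerKernel_mul hα one_pos hα ht
  have h2 : mittagLefflerKernel α 1 t * ((t - 0) ^ α / α) ≤
      ∫ s in (0 : ℝ)..t, mittagLefflerKernel α 1 s * (t - s) ^ (α - 1) := by
    rw [← integral_sub_rpow hα, ← intervalIntegral.integral_const_mul]
    refine intervalIntegral.integral_mono_on_of_le_Ioo ht.le
      ((intervalIntegrable_sub_rpow hα).const_mul _)
      (intervalIntegrable_mittagLefflerKernel_mul hα one_pos hα ht) fun s hs => ?_
    exact mul_le_mul_of_nonneg_right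
      (mittagLefflerKernel_one_antitoneOn hα hα1 hs.1 ht hs.2.le)
      (Real.rpow_nonneg (sub_nonneg.2 hs.2.le) _)
  rw [h1, sub_zero, add_comm 1 α] at h2
  have h3 : mittagLefflerKernel α (α + 1) t ≤ 1 := by
    linarith [mittagLefflerKernel_one_add hα ht, mittagLefflerKernel_one_nonneg hα hα1 ht]
  have h4 := h2.trans (mul_le_mul_of_nonneg_left h3 hΓ.le)
  have hT : 0 < t ^ α := Real.rpow_pos_of_pos ht _
  rw [Real.rpow_neg ht.le, ← div_eq_mul_inv, le_div_iff₀ hT]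
  rw [← mul_div_assoc, div_le_iff₀ hα] at h4
  linarith

theorem tendsto_mittagLefflerKernel_one {α : ℝ} (hα : 0 < α) (hα1 : α < 1) :
    Tendsto (mittagLefflerKernel α 1) atTop (𝓝 0) := by
  have h := (tendsto_rpow_neg_atTop hα).const_mul (α * Real.Gamma α)
  rw [mul_zero] at h
  refine tendsto_of_tendsto_of_tendsto_of_le_of_le' tendsto_const_nhds h ?_ ?_
  · filter_upwards [eventually_gt_atTop 0] with t ht
    exact mittagLefflerKernel_one_nonneg hα hα1 ht
  · filter_upwards [eventually_gt_atTop 0] with t ht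
    exact mittagLefflerKernel_one_le_rpow_neg hα hα1 ht

theorem one_sub_div_Gamma_le_rpow_mul_mittagLefflerKernel {α t : ℝ} (hα : 0 < α) (hα1 : α < 1)
    (ht : 0 < t) :
    (1 - mittagLefflerKernel α 1 t) / Real.Gamma (1 - α) ≤ t ^ α * mittagLefflerKernel α 1 t := by
  have hγ : 0 < 1 - α := by linarith
  have h1 := integral_mittagLefflerKernel_mul hα hα hγ ht
  have h2 : t ^ (1 - α - 1) * mittagLefflerKernel α (α + 1) t ≤
      ∫ s in (0 : ℝ)..t, mittagLefflerKernel α α s * (t - s) ^ (1 - α - 1) := by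
    rw [← integral_mittagLefflerKernel hα hα ht, ← intervalIntegral.integral_const_mul]
    refine intervalIntegral.integral_mono_on_of_le_Ioo ht.le
      ((intervalIntegrable_mittagLefflerKernel hα hα ht).const_mul _)
      (intervalIntegrable_mittagLefflerKernel_mul hα hα hγ ht) fun s hs => ?_
    rw [mul_comm]
    refine mul_le_mul_of_nonneg_left ?_ (mittagLefflerKernel_self_pos hα hα1 hs.1).le
    exact Real.rpow_le_rpow_of_nonpos (sub_pos.2 hs.2) (by linarith [hs.1]) (by linarith)
  rw [h1, add_sub_cancel, show 1 - α - 1 = -α by ring, Real.rpow_neg ht.le] at h2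
  have hT : 0 < t ^ α := Real.rpow_pos_of_pos ht _
  rw [div_le_iff₀ (Real.Gamma_pos_of_pos hγ), sub_eq_of_eq_add' (mittagLefflerKernel_one_add hα ht).symm]
  rw [inv_mul_le_iff₀ hT] at h2
  linarith

theorem tendsto_mittagLefflerKernel_two_div {α : ℝ} (hα : 0 < α) (hα1 : α < 1) :
    Tendsto (fun t => mittagLefflerKernel α (1 + 1) t / t ^ (1 - α)) atTop
      (𝓝 (1 / Real.Gamma (2 - α))) := by
  have hγ : 0 < 1 - α := by linarith
  set C := α * Real.Gamma α * ProbabilityTheory.beta (1 - α) (1 - α) / Real.Gamma (1 - α) with hC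
  have hbound : ∀ t, 0 < t → mittagLefflerKernel α (1 + (1 - α)) t ≤ t ^ (1 - α) * (C * t ^ (-α)) :=
      fun t ht => by
    have h1 := integral_mittagLefflerKernel_mul hα one_pos hγ ht
    have h2 : ∫ s in (0 : ℝ)..t, mittagLefflerKernel α 1 s * (t - s) ^ (1 - α - 1) ≤
        α * Real.Gamma α * (t ^ (1 - α + (1 - α) - 1) *
          ProbabilityTheory.beta (1 - α) (1 - α)) := by
      rw [← integral_rpow_mul_sub_rpow hγ hγ ht, ← intervalIntegral.integral_const_mul]
      refine intervalIntegral.integral_mono_on_of_le_Ioo ht.le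
        (intervalIntegrable_mittagLefflerKernel_mul hα one_pos hγ ht)
        ((intervalIntegrable_rpow_mul_sub_rpow hγ hγ ht).const_mul _) fun s hs => ?_
      rw [← mul_assoc]
      refine mul_le_mul_of_nonneg_right ?_ (Real.rpow_nonneg (sub_nonneg.2 hs.2.le) _)
      rw [show 1 - α - 1 = -α by ring]
      exact mittagLefflerKernel_one_le_rpow_neg hα hα1 hs.1
    rw [h1, show 1 - α + (1 - α) - 1 = (1 - α) + -α by ring, Real.rpow_add ht,
      mul_comm (Real.Gamma (1 - α)), ← le_div_iff₀ (Real.Gamma_pos_of_pos hγ)] at h2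
    refine h2.trans (le_of_eq ?_)
    rw [hC]
    ring
  have heq : ∀ t, 0 < t → mittagLefflerKernel α (1 + 1) t / t ^ (1 - α) =
      1 / Real.Gamma (2 - α) - mittagLefflerKernel α (1 + (1 - α)) t / t ^ (1 - α) :=
      fun t ht => by
    have h := mittagLefflerKernel_add hα (by linarith : 0 < 1 + (1 - α)) ht
    rw [show 1 + (1 - α) + α = 1 + 1 by ring, add_sub_cancel_left] at h
    rw [eq_sub_of_add_eq' h, show 1 + (1 - α) = 2 - α by ring]
    have hT : 0 < t ^ (1 - α) := Real.rpow_pos_of_pos ht _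
    field_simp
  have hlim : Tendsto (fun t => mittagLefflerKernel α (1 + (1 - α)) t / t ^ (1 - α)) atTop
      (𝓝 0) := by
    have h := (tendsto_rpow_neg_atTop hα).const_mul C
    rw [mul_zero] at h
    refine tendsto_of_tendsto_of_tendsto_of_le_of_le' tendsto_const_nhds h ?_ ?_
    · filter_upwards [eventually_gt_atTop 0] with t ht
      exact div_nonneg (mittagLefflerKernel_nonneg_of_add hα one_pos hγ ht
        fun s hs => mittagLefflerKernel_one_nonneg hα hα1 hs) (Real.rpow_nonneg ht.le _)
    · filter_upwards [eventually_gt_atTop 0] with t ht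
      rw [div_le_iff₀' (Real.rpow_pos_of_pos ht _)]
      exact hbound t ht
  have h := (tendsto_const_nhds (x := 1 / Real.Gamma (2 - α))).sub hlim
  rw [sub_zero] at h
  refine h.congr' ?_
  filter_upwards [eventually_gt_atTop 0] with t ht
  exact (heq t ht).symm

theorem one_sub_one_sub_rpow_le {α δ : ℝ} (hα : 0 < α) (hα1 : α < 1) (hδ : 0 < δ) (hδ1 : δ < 1) :
    1 - (1 - δ) ^ (1 - α) ≤ δ * (1 - α + α * δ) := by
  have h1 : (1 - δ) ^ α ≤ 1 - α * δ := by
    have h := rpow_one_add_le_one_add_mul_self (s := -δ) (by linarith) hα.le hα1.le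
    rw [← sub_eq_add_neg] at h
    linarith
  have hp : 0 < 1 - δ := by linarith
  have hX : 0 < (1 - δ) ^ α := Real.rpow_pos_of_pos hp _
  have h2 : (1 - δ) * (1 + α * δ) ≤ (1 - δ) ^ (1 - α) := by
    rw [Real.rpow_sub hp, Real.rpow_one, le_div_iff₀ hX, mul_assoc]
    refine mul_le_of_le_one_right hp.le ?_
    calc _ ≤ (1 + α * δ) * (1 - α * δ) := by gcongr
      _ ≤ 1 := by nlinarith [sq_nonneg (α * δ)]
  linarith

theorem eventually_rpow_mul_mittagLefflerKernel_lt {α b : ℝ} (hα : 0 < α) (hα1 : α < 1)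
    (hb : 1 / Real.Gamma (1 - α) < b) :
    ∀ᶠ t in atTop, t ^ α * mittagLefflerKernel α 1 t < b := by
  have hγ : 0 < 1 - α := by linarith
  set A := 1 / Real.Gamma (2 - α) with hA
  have hA0 : 0 < A := one_div_pos.2 (Real.Gamma_pos_of_pos (by linarith))
  have hAL : A * (1 - α) = 1 / Real.Gamma (1 - α) := by
    have := Real.Gamma_pos_of_pos hγ
    rw [hA, show 2 - α = (1 - α) + 1 by ring, Real.Gamma_add_one hγ.ne']
    field_simp
  rw [← hAL] at hb
  obtain ⟨δ, hδ, hδ1, hδb⟩ : ∃ δ, 0 < δ ∧ δ < 1 ∧ A * (1 - α + α * δ) < b := by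
    have hc : Continuous fun δ : ℝ => A * (1 - α + α * δ) := by fun_prop
    have h1 : ∀ᶠ δ in 𝓝 (0 : ℝ), A * (1 - α + α * δ) < b :=
      hc.continuousAt.eventually_lt continuousAt_const (by simpa using hb)
    have h2 : ∀ᶠ δ in 𝓝[>] (0 : ℝ), 0 < δ := eventually_mem_nhdsWithin
    exact (h2.and (((eventually_lt_nhds one_pos).filter_mono nhdsWithin_le_nhds).and
      (h1.filter_mono nhdsWithin_le_nhds))).exists
  have hd : 0 < 1 - δ := by linarith
  set G : ℝ → ℝ := fun t => mittagLefflerKernel α (1 + 1) t / t ^ (1 - α) with hG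
  have hG1 : Tendsto G atTop (𝓝 A) := tendsto_mittagLefflerKernel_two_div hα hα1
  have hG2 : Tendsto (fun t => G ((1 - δ) * t)) atTop (𝓝 A) :=
    hG1.comp (tendsto_id.const_mul_atTop hd)
  have hlim := (hG1.sub (hG2.const_mul ((1 - δ) ^ (1 - α)))).div_const δ
  have hlt : (A - (1 - δ) ^ (1 - α) * A) / δ < b := by
    refine lt_of_le_of_lt ?_ hδb
    rw [div_le_iff₀ hδ]
    have := mul_le_mul_of_nonneg_left (one_sub_one_sub_rpow_le hα hα1 hδ hδ1) hA0.le
    linarith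
  filter_upwards [hlim.eventually_lt_const hlt, eventually_gt_atTop 0] with t hlt ht
  refine lt_of_le_of_lt ?_ hlt
  have h1 := sub_mul_le_mittagLefflerKernel_sub hα hα1 (mul_pos hd ht)
    (by nlinarith : (1 - δ) * t ≤ t)
  have hT : 0 < t ^ (1 - α) := Real.rpow_pos_of_pos ht _
  have hD : 0 < (1 - δ) ^ (1 - α) := Real.rpow_pos_of_pos hd _
  have h2 : t ^ α * t ^ (1 - α) = t := by rw [← Real.rpow_add ht]; simp
  have h3 : (1 - δ) ^ (1 - α) * G ((1 - δ) * t) =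
      mittagLefflerKernel α (1 + 1) ((1 - δ) * t) / t ^ (1 - α) := by
    simp only [hG]
    rw [Real.mul_rpow hd.le ht.le]
    field_simp
  rw [h3, hG, le_div_iff₀ hδ, ← sub_div, le_div_iff₀ hT]
  calc _ = (t ^ α * t ^ (1 - α)) * δ * mittagLefflerKernel α 1 t := by ring
    _ = (t - (1 - δ) * t) * mittagLefflerKernel α 1 t := by rw [h2]; ring
    _ ≤ _ := h1

/-- For every real `α` with `0 < α < 1`, `x^α · E_α(-x^α) → 1/Γ(1-α)` as `x → +∞`;
in particular, `E_α(-x^α) → 0` as `x → +∞`. -/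
theorem mittagLeffler_asymptotic_atTop (α : ℝ) (hα : 0 < α) (hα1 : α < 1) :
    Filter.Tendsto (fun x : ℝ => x ^ α * mittagLeffler α 1 (-(x ^ α)))
      Filter.atTop (nhds (1 / Real.Gamma (1 - α))) ∧
    Filter.Tendsto (fun x : ℝ => mittagLeffler α 1 (-(x ^ α)))
      Filter.atTop (nhds 0) := by
  have hker : mittagLefflerKernel α 1 = fun x => mittagLeffler α 1 (-(x ^ α)) := by
    ext x
    simp [mittagLefflerKernel]
  have h0 := tendsto_mittagLefflerKernel_one hα hα1
  refine ⟨tendsto_order.2 ⟨fun a ha => ?_, fun b hb => ?_⟩, by rwa [hker] at h0⟩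
  · have hlow := ((tendsto_const_nhds (x := (1 : ℝ))).sub h0).div_const (Real.Gamma (1 - α))
    rw [sub_zero] at hlow
    filter_upwards [hlow.eventually_const_lt ha, eventually_gt_atTop 0] with t hlt ht
    have h := hlt.trans_le (one_sub_div_Gamma_le_rpow_mul_mittagLefflerKernel hα hα1 ht)
    rwa [hker] at h
  · have h := eventually_rpow_mul_mittagLefflerKernel_lt hα hα1 hb
    rwa [hker] at h
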